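/- arXiv:2407.19444 — 4 statements merged into one kernel-verified Lean document; each statement's English description precedes it below -/
import Mathlib

section
/- If a set R ⊆ ℕ is ({0, …, N−1})-nicely intersective (i.e. nicely intersective with respect to the Følner sequence F_N = {0, 1, …, N−1}), then R is (F_N)-nicely intersective with respect to every Følner sequence (F_N) in ℕ. -/
open MeasureTheory Filter
open scoped Classical symmDiff

/-- The upper density of `E ⊆ ℕ` with respect to a sequence `F` of finite subsets of `ℕ`. -/
noncomputable def upperDensity (F : ℕ → Finset ℕ) (E : Set ℕ) : ℝ :=
  limsup (fun N : ℕ => (((F N).filter (· ∈ E)).card : ℝ) / (F N).card) atTop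

/-- `F` is a Følner sequence in `ℕ`: `|F_N ∆ (F_N + t)| / |F_N| → 0` for every `t`. -/
def IsFolner (F : ℕ → Finset ℕ) : Prop :=
  ∀ t : ℕ,
    Tendsto (fun N : ℕ => (((F N) ∆ ((F N).image (· + t))).card : ℝ) / (F N).card)
      atTop (nhds 0)

/-- `R ⊆ ℕ` is a set of nice recurrence: for every measure preserving system `(X, μ, T)`,
every measurable `A ⊆ X` and every `ε > 0` there is a nonzero `r ∈ R` with
`μ(A ∩ T^{-r}A) > μ(A)² - ε`. -/
def IsNiceRecurrenceSet (R : Set ℕ) : Prop :=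
  ∀ (X : Type) (_ : MeasurableSpace X) (μ : Measure X) (T : X → X),
    IsProbabilityMeasure μ → Measurable T → MeasurePreserving T μ μ →
    ∀ A : Set X, MeasurableSet A → ∀ ε : ℝ, 0 < ε →
      ∃ r ∈ R, r ≠ 0 ∧ (μ (A ∩ T^[r] ⁻¹' A)).toReal > (μ A).toReal ^ 2 - ε

/-- `R ⊆ ℕ` is a set of recurrence: for every measure preserving system `(X, μ, T)` and
every measurable `A ⊆ X` with `μ(A) > 0` there is a nonzero `r ∈ R` with
`μ(A ∩ T^{-r}A) > 0`. -/
def IsRecurrenceSet (R : Set ℕ) : Prop :=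
  ∀ (X : Type) (_ : MeasurableSpace X) (μ : Measure X) (T : X → X),
    IsProbabilityMeasure μ → Measurable T → MeasurePreserving T μ μ →
    ∀ A : Set X, MeasurableSet A → 0 < μ A →
      ∃ r ∈ R, r ≠ 0 ∧ 0 < μ (A ∩ T^[r] ⁻¹' A)

/-- `R` is `(F_N)`-nicely intersective: for every `E ⊆ ℕ` and `ε > 0` there is a nonzero
`r ∈ R` with `d̄_F(E ∩ (E - r)) > d̄_F(E)² - ε`. -/
def NicelyIntersective (F : ℕ → Finset ℕ) (R : Set ℕ) : Prop :=
  ∀ E : Set ℕ, ∀ ε : ℝ, 0 < ε →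
    ∃ r ∈ R, r ≠ 0 ∧
      upperDensity F (E ∩ {m : ℕ | m + r ∈ E}) > (upperDensity F E) ^ 2 - ε

/-- `R` is `(F_N)`-intersective: every `E ⊆ ℕ` of positive upper density contains two
elements differing by a nonzero element of `R`. -/
def Intersective (F : ℕ → Finset ℕ) (R : Set ℕ) : Prop :=
  ∀ E : Set ℕ, 0 < upperDensity F E →
    ∃ r ∈ R, r ≠ 0 ∧ (E ∩ {m : ℕ | m + r ∈ E}).Nonempty

/-- The number of elements of the finite set `s` lying in `A`. -/
noncomputable def Finset.countIn (s : Finset ℕ) (A : Set ℕ) : ℕ :=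
  (s.filter (· ∈ A)).card

theorem Finset.countIn_le_card (s : Finset ℕ) (A : Set ℕ) : s.countIn A ≤ s.card :=
  Finset.card_filter_le _ _

theorem Finset.countIn_le_countIn {s : Finset ℕ} {A B : Set ℕ} (h : ∀ m ∈ s, m ∈ A → m ∈ B) :
    s.countIn A ≤ s.countIn B := by
  refine Finset.card_le_card fun m hm => ?_
  obtain ⟨h1, h2⟩ := Finset.mem_filter.1 hm
  exact Finset.mem_filter.2 ⟨h1, h m h1 h2⟩

theorem Finset.countIn_le_add {s : Finset ℕ} {A B C : Set ℕ}
    (h : ∀ m ∈ s, m ∈ A → m ∈ B ∨ m ∈ C) : s.countIn A ≤ s.countIn B + s.countIn C := by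
  refine (Finset.card_le_card fun m hm => ?_).trans (Finset.card_union_le _ _)
  obtain ⟨h1, h2⟩ := Finset.mem_filter.1 hm
  rw [Finset.mem_union, Finset.mem_filter, Finset.mem_filter]
  exact (h m h1 h2).imp (And.intro h1) (And.intro h1)

theorem Finset.countIn_add_countIn_compl (s : Finset ℕ) (A : Set ℕ) :
    s.countIn A + s.countIn Aᶜ = s.card := by
  have h : s.countIn Aᶜ = (s.filter (· ∉ A)).card := by
    unfold Finset.countIn
    congr 1
    ext
    simp only [Finset.mem_filter, Set.mem_compl_iff]
  rw [h]
  exact Finset.card_filter_add_card_filter_not (s := s) (· ∈ A)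

theorem Finset.countIn_le_card_of_injective {s t : Finset ℕ} {A : Set ℕ} {f : ℕ → ℕ}
    (hf : Function.Injective f) (h : ∀ m ∈ s, m ∈ A → f m ∈ t) : s.countIn A ≤ t.card := by
  unfold Finset.countIn
  rw [← Finset.card_image_of_injective _ hf]
  refine Finset.card_le_card fun k hk => ?_
  obtain ⟨m, hm, rfl⟩ := Finset.mem_image.1 hk
  obtain ⟨h1, h2⟩ := Finset.mem_filter.1 hm
  exact h m h1 h2

theorem Finset.countIn_range_add_countIn_Ico (A : Set ℕ) {a d : ℕ} (had : a ≤ d) :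
    (Finset.range a).countIn A + (Finset.Ico a d).countIn A = (Finset.range d).countIn A := by
  unfold Finset.countIn
  rw [← Finset.card_union_of_disjoint, ← Finset.filter_union]
  · simp only [Finset.range_eq_Ico]
    rw [Finset.Ico_union_Ico_eq_Ico (Nat.zero_le a) had]
  · refine Finset.disjoint_filter_filter ?_
    simp only [Finset.range_eq_Ico]
    exact Finset.Ico_disjoint_Ico_consecutive _ _ _

theorem exists_tendsto_atTop_comp_le (g : ℕ → ℕ) :
    ∃ κ : ℕ → ℕ, Tendsto κ atTop atTop ∧ ∀ᶠ j in atTop, g (κ j) ≤ j := by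
  refine ⟨fun j => Nat.findGreatest (fun k => g k ≤ j) j, ?_, ?_⟩
  · refine tendsto_atTop.2 fun k => ?_
    filter_upwards [eventually_ge_atTop (max k (g k))] with j hj
    exact Nat.le_findGreatest (le_of_max_le_left hj) (le_of_max_le_right hj)
  · filter_upwards [eventually_ge_atTop (g 0)] with j hj
    exact Nat.findGreatest_spec (P := fun k => g k ≤ j) (Nat.zero_le j) hj

theorem StrictMono.exists_block_index {s : ℕ → ℕ} (hs : StrictMono s) (h0 : s 0 = 0) :
    ∃ b : ℕ → ℕ, ∀ m j, b m = j ↔ s j ≤ m ∧ m < s (j + 1) := by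
  have key : ∀ m, ∃ j, s j ≤ m ∧ m < s (j + 1) := by
    intro m
    refine ⟨Nat.findGreatest (fun j => s j ≤ m) m, ?_, ?_⟩
    · exact Nat.findGreatest_spec (P := fun j => s j ≤ m) (Nat.zero_le m) (by simp [h0])
    · by_contra! h
      exact absurd (Nat.le_findGreatest (P := fun j => s j ≤ m) ((hs.id_le _).trans h) h)
        (Nat.not_succ_le_self _)
  choose b hb1 hb2 using key
  refine ⟨b, fun m j => ⟨fun h => h ▸ ⟨hb1 m, hb2 m⟩, fun ⟨h1, h2⟩ => ?_⟩⟩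
  have h3 := hs.lt_iff_lt.1 ((hb1 m).trans_lt h2)
  have h4 := hs.lt_iff_lt.1 (h1.trans_lt (hb2 m))
  omega

theorem strictMono_sum_range {p : ℕ → ℕ} (hp : ∀ j, 0 < p j) :
    StrictMono fun j => ∑ i ∈ Finset.range j, p i :=
  strictMono_nat_of_lt_succ fun j => by
    rw [Finset.sum_range_succ]
    exact Nat.lt_add_of_pos_right (hp j)

/-- Upper bounds on the frequency of `D` in consecutive blocks, whose lengths are negligible
compared with their index, pass to the frequency of `D` in initial segments. -/
theorem eventually_countIn_range_le_of_blocks {p : ℕ → ℕ} (hp : ∀ j, 0 < p j)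
    (hsmall : ∀ η : ℝ, 0 < η → ∀ᶠ j : ℕ in atTop, (p j : ℝ) ≤ η * j)
    (D : Set ℕ) {c : ℝ} (hc : 0 ≤ c)
    (hD : ∀ᶠ j : ℕ in atTop,
      ((Finset.Ico (∑ i ∈ Finset.range j, p i) (∑ i ∈ Finset.range (j + 1), p i)).countIn D : ℝ) ≤
        c * p j)
    {η : ℝ} (hη : 0 < η) :
    ∀ᶠ n : ℕ in atTop, ((Finset.range n).countIn D : ℝ) ≤ (c + η) * n := by
  set s : ℕ → ℕ := fun j => ∑ i ∈ Finset.range j, p i with hs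
  have hmono : StrictMono s := strictMono_sum_range hp
  have hsucc : ∀ j, s (j + 1) = s j + p j := fun j => Finset.sum_range_succ _ _
  obtain ⟨b, hb⟩ := hmono.exists_block_index (by simp [hs])
  obtain ⟨J, hJ⟩ := eventually_atTop.1 (hD.and (hsmall (η / 2) (half_pos hη)))
  have split : ∀ a d : ℕ, a ≤ d → ((Finset.range d).countIn D : ℝ) =
      (Finset.range a).countIn D + (Finset.Ico a d).countIn D := by
    intro a d had
    exact_mod_cast (Finset.countIn_range_add_countIn_Ico D had).symm
  have step : ∀ j, J ≤ j →
      ((Finset.range (s j)).countIn D : ℝ) ≤ s J + c * s j := by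
    intro j hj
    induction j, hj using Nat.le_induction with
    | base =>
      have h1 : ((Finset.range (s J)).countIn D : ℝ) ≤ s J := by
        exact_mod_cast (Finset.countIn_le_card _ _).trans (Finset.card_range _).le
      have : 0 ≤ c * s J := by positivity
      linarith
    | succ j hj ih =>
      rw [split (s j) (s (j + 1)) (hmono.monotone (Nat.le_succ j))]
      have h1 := (hJ j hj).1
      have h2 : (s (j + 1) : ℝ) = s j + p j := by exact_mod_cast hsucc j
      rw [h2]
      have h3 : ((Finset.Ico (s j) (s (j + 1))).countIn D : ℝ) ≤ c * p j := h1
      linarith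
  obtain ⟨K, hK⟩ := exists_nat_ge ((s J : ℝ) / (η / 2))
  filter_upwards [eventually_ge_atTop (max K (s J))] with n hn
  obtain ⟨h1, h2⟩ := (hb n (b n)).1 rfl
  have hbJ : J ≤ b n := by
    have := hmono.lt_iff_lt.1 ((le_of_max_le_right hn).trans_lt h2)
    omega
  have h3 := step _ hbJ
  have h4 := (hJ _ hbJ).2
  have h5 : ((Finset.Ico (s (b n)) n).countIn D : ℝ) ≤ p (b n) := by
    have := (Finset.countIn_le_card (Finset.Ico (s (b n)) n) D)
    rw [Nat.card_Ico] at this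
    have h6 := hsucc (b n)
    exact_mod_cast (show _ ≤ _ by omega)
  have h6 : (b n : ℝ) ≤ n := by exact_mod_cast (hmono.id_le _).trans h1
  have h7 : (s (b n) : ℝ) ≤ n := by exact_mod_cast h1
  have h8 : (s J : ℝ) ≤ η / 2 * n := by
    have : (K : ℝ) ≤ n := by exact_mod_cast le_of_max_le_left hn
    have := hK.trans this
    rw [div_le_iff₀ (half_pos hη)] at this
    linarith
  rw [split _ _ h1]
  have h9 := mul_le_mul_of_nonneg_left h6 (half_pos hη).le
  have h10 := mul_le_mul_of_nonneg_left h7 hc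
  linarith

/-- The concatenation of the increasing enumerations of finite sets `G 0, G 1, …`. -/
theorem exists_concat_enumeration (G : ℕ → Finset ℕ) (hG : ∀ j, 0 < (G j).card) :
    ∃ x : ℕ → ℕ, ∀ j,
      (∀ A : Set ℕ, (Finset.Ico (∑ i ∈ Finset.range j, (G i).card)
        (∑ i ∈ Finset.range (j + 1), (G i).card)).countIn {m : ℕ | x m ∈ A} =
          (G j).countIn A) ∧
      ∀ m ∈ Finset.Ico (∑ i ∈ Finset.range j, (G i).card)
        (∑ i ∈ Finset.range (j + 1), (G i).card),
        x m + 1 ∈ G j → x (m + 1) = x m + 1 := by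
  set s : ℕ → ℕ := fun j => ∑ i ∈ Finset.range j, (G i).card with hs
  have hmono : StrictMono s := strictMono_sum_range hG
  have hsucc : ∀ j, s (j + 1) = s j + (G j).card := fun j => Finset.sum_range_succ _ _
  obtain ⟨b, hb⟩ := hmono.exists_block_index (by simp [hs])
  have hfin : ∀ j, {n | n ∈ G j}.Finite := fun j => (G j).finite_toSet
  have hcard : ∀ j, (hfin j).toFinset.card = (G j).card := fun j => by
    congr 1; ext; exact (hfin j).mem_toFinset
  set x : ℕ → ℕ := fun m => Nat.nth (· ∈ G (b m)) (m - s (b m)) with hx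
  have hx_mem : ∀ j m, m < (G j).card → Nat.nth (· ∈ G j) m ∈ G j := fun j m hm =>
    Nat.nth_mem_of_lt_card (hfin j) (by rwa [hcard])
  have hx_count : ∀ j, ∀ n ∈ G j, Nat.nth (· ∈ G j) (Nat.count (· ∈ G j) n) = n ∧
      Nat.count (· ∈ G j) n < (G j).card := fun j n hn =>
    ⟨Nat.nth_count hn, (hcard j) ▸ Nat.count_lt_card (hfin j) hn⟩
  have hx_eq : ∀ j m, s j ≤ m → m < s (j + 1) → x m = Nat.nth (· ∈ G j) (m - s j) := by
    intro j m h1 h2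
    simp only [hx, (hb m j).2 ⟨h1, h2⟩]
  refine ⟨x, fun j => ⟨fun A => ?_, fun m hm hm1 => ?_⟩⟩
  · refine Finset.card_bij (fun m _ => x m) ?_ ?_ ?_
    · intro m hm
      obtain ⟨hm, hA⟩ := Finset.mem_filter.1 hm
      obtain ⟨h1, h2⟩ := Finset.mem_Ico.1 hm
      refine Finset.mem_filter.2 ⟨?_, hA⟩
      rw [hx_eq j m h1 h2]
      exact hx_mem _ _ (by
        have := hsucc j
        change s j ≤ m at h1
        change m < s (j + 1) at h2
        omega)
    · intro m hm m' hm' h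
      obtain ⟨h1, h2⟩ := Finset.mem_Ico.1 (Finset.mem_filter.1 hm).1
      obtain ⟨h1', h2'⟩ := Finset.mem_Ico.1 (Finset.mem_filter.1 hm').1
      change s j ≤ m at h1
      change s j ≤ m' at h1'
      change m < s (j + 1) at h2
      change m' < s (j + 1) at h2'
      rw [hx_eq j m h1 h2, hx_eq j m' h1' h2'] at h
      have h3 := hsucc j
      have := Nat.nth_injOn (hfin j) (by rw [hcard, Set.mem_Iio]; omega)
        (by rw [hcard, Set.mem_Iio]; omega) h
      omega
    · intro n hn
      obtain ⟨hn, hA⟩ := Finset.mem_filter.1 hn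
      obtain ⟨h1, h2⟩ := hx_count j n hn
      have h3 : x (s j + Nat.count (· ∈ G j) n) = n := by
        rw [hx_eq j _ (Nat.le_add_right _ _) (by rw [hsucc]; omega), Nat.add_sub_cancel_left, h1]
      refine ⟨s j + Nat.count (· ∈ G j) n, ?_, h3⟩
      refine Finset.mem_filter.2 ⟨Finset.mem_Ico.2 ⟨Nat.le_add_right _ _, ?_⟩, ?_⟩
      · change _ < s (j + 1)
        rw [hsucc]
        omega
      · change x _ ∈ A
        rwa [h3]
  · obtain ⟨h1, h2⟩ := Finset.mem_Ico.1 hm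
    change s j ≤ m at h1
    change m < s (j + 1) at h2
    have h3 := hsucc j
    have hlt : m - s j < (G j).card := by omega
    rw [hx_eq j m h1 h2] at hm1 ⊢
    set n := Nat.nth (· ∈ G j) (m - s j) with hn
    have hnG : n ∈ G j := hx_mem j _ hlt
    have hcn : Nat.count (· ∈ G j) n = m - s j :=
      Nat.count_nth fun _ => hlt.trans_eq (hcard j).symm
    have hcs : Nat.count (· ∈ G j) (n + 1) = m - s j + 1 := by
      rw [Nat.count_succ, hcn, if_pos hnG]
    obtain ⟨h4, h5⟩ := hx_count j _ hm1
    rw [hcs] at h4 h5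
    rw [hx_eq j (m + 1) (by omega) (by omega), show m + 1 - s j = m - s j + 1 by omega, h4]

theorem countIn_range_add_le (A : Set ℕ) (n r : ℕ) :
    (Finset.range n).countIn {m : ℕ | m + r ∈ A} ≤
      (Finset.range n).countIn A + r := by
  have h : (Finset.range n).countIn {m : ℕ | m + r ∈ A} ≤
      ((Finset.range n).filter (· ∈ A) ∪ Finset.Ico n (n + r)).card := by
    refine Finset.countIn_le_card_of_injective (add_left_injective r) fun m hm hA => ?_
    rw [Finset.mem_union, Finset.mem_filter, Finset.mem_Ico, Finset.mem_range]
    rw [Finset.mem_range] at hm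
    by_cases hmr : m + r < n
    · exact Or.inl ⟨hmr, hA⟩
    · exact Or.inr (by omega)
  refine h.trans ((Finset.card_union_le _ _).trans ?_)
  rw [Nat.card_Ico, Nat.add_sub_cancel_left]
  rfl

/-- If `x (m + 1) = x m + 1` off a set of density zero, the same holds for longer steps. -/
theorem eventually_countIn_add_ne_le {x : ℕ → ℕ}
    (hx : ∀ η : ℝ, 0 < η → ∀ᶠ n : ℕ in atTop,
      ((Finset.range n).countIn {m : ℕ | x (m + 1) ≠ x m + 1} : ℝ) ≤ η * n) (r : ℕ) :
    ∀ η : ℝ, 0 < η → ∀ᶠ n : ℕ in atTop,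
      ((Finset.range n).countIn {m : ℕ | x (m + r) ≠ x m + r} : ℝ) ≤ η * n := by
  induction r with
  | zero =>
    intro η hη
    refine Eventually.of_forall fun n => ?_
    have h : (Finset.range n).countIn {m : ℕ | x (m + 0) ≠ x m + 0} = 0 :=
      by simp [Finset.countIn]
    rw [h, Nat.cast_zero]
    positivity
  | succ r ih =>
    intro η hη
    obtain ⟨K, hK⟩ := exists_nat_ge ((r : ℝ) / (η / 3))
    filter_upwards [ih (η / 3) (by positivity), hx (η / 3) (by positivity),
      eventually_ge_atTop K] with n h1 h2 h3
    have h4 : (Finset.range n).countIn {m : ℕ | x (m + (r + 1)) ≠ x m + (r + 1)} ≤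
        (Finset.range n).countIn {m : ℕ | x (m + r) ≠ x m + r} +
          (Finset.range n).countIn {m : ℕ | m + r ∈ {m : ℕ | x (m + 1) ≠ x m + 1}} := by
      refine Finset.countIn_le_add fun m _ hm => ?_
      by_cases hmr : x (m + r) = x m + r
      · refine Or.inr fun h => hm ?_
        rw [← add_assoc, h, hmr, add_assoc]
      · exact Or.inl hmr
    have h5 := countIn_range_add_le {m : ℕ | x (m + 1) ≠ x m + 1} n r
    have h6 : ((Finset.range n).countIn {m : ℕ | x (m + (r + 1)) ≠ x m + (r + 1)} : ℝ) ≤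
        (Finset.range n).countIn {m : ℕ | x (m + r) ≠ x m + r} +
        ((Finset.range n).countIn {m : ℕ | x (m + 1) ≠ x m + 1} + r) := by
      exact_mod_cast h4.trans (Nat.add_le_add_left h5 _)
    have h7 : (r : ℝ) ≤ η / 3 * n := by
      have : (K : ℝ) ≤ n := by exact_mod_cast h3
      have := hK.trans this
      rw [div_le_iff₀ (by positivity)] at this
      linarith
    linarith

theorem countIn_succ_notMem_le (G : Finset ℕ) :
    G.countIn {n : ℕ | n + 1 ∉ G} ≤ (G ∆ (G.image (· + 1))).card := 
  Finset.countIn_le_card_of_injective (add_left_injective 1) fun _ hm1 hm2 =>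
    Finset.mem_symmDiff.2 (Or.inr ⟨Finset.mem_image_of_mem _ hm1, hm2⟩)

theorem density_ratio_mem_Icc (G : Finset ℕ) (E : Set ℕ) :
    (G.countIn E : ℝ) / G.card ∈ Set.Icc (0 : ℝ) 1 :=
  ⟨by positivity, div_le_one_of_le₀ (by exact_mod_cast Finset.countIn_le_card _ _) (by positivity)⟩

theorem isBoundedUnder_le_density_ratio (F : ℕ → Finset ℕ) (E : Set ℕ) :
    IsBoundedUnder (· ≤ ·) atTop
      fun N : ℕ => ((F N).countIn E : ℝ) / (F N).card :=
  isBoundedUnder_of ⟨1, fun N => (density_ratio_mem_Icc (F N) E).2⟩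

theorem isBoundedUnder_ge_density_ratio (F : ℕ → Finset ℕ) (E : Set ℕ) :
    IsBoundedUnder (· ≥ ·) atTop
      fun N : ℕ => ((F N).countIn E : ℝ) / (F N).card :=
  isBoundedUnder_of ⟨0, fun N => (density_ratio_mem_Icc (F N) E).1⟩

theorem upperDensity_nonneg (F : ℕ → Finset ℕ) (E : Set ℕ) : 0 ≤ upperDensity F E :=
  le_limsup_of_frequently_le
    (Frequently.of_forall fun N => (density_ratio_mem_Icc (F N) E).1)
    (isBoundedUnder_le_density_ratio F E)

/-- A subsequence of `F` consisting of nonempty sets, along which the upper density of `E` is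
attained. -/
theorem exists_subseq_upperDensity (F : ℕ → Finset ℕ) (E : Set ℕ) (hE : 0 < upperDensity F E) :
    ∃ N : ℕ → ℕ, Tendsto N atTop atTop ∧ (∀ k, 0 < (F (N k)).card) ∧
      ∀ η : ℝ, 0 < η → ∀ᶠ k in atTop,
        (upperDensity F E - η) * (F (N k)).card ≤ (F (N k)).countIn E := by
  have key : ∀ k : ℕ, ∃ N : ℕ, k ≤ N ∧ max 0 (upperDensity F E - 1 / ((k : ℝ) + 1)) <
      ((F N).countIn E : ℝ) / (F N).card := by
    intro k
    have hlt : max 0 (upperDensity F E - 1 / ((k : ℝ) + 1)) < upperDensity F E :=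
      max_lt hE (sub_lt_self _ (by positivity))
    have := frequently_lt_of_lt_limsup
      (isBoundedUnder_ge_density_ratio F E).isCoboundedUnder_le hlt
    exact (frequently_atTop.1 this) k
  choose N hN1 hN2 using key
  have hpos : ∀ k, 0 < (F (N k)).card := fun k => by
    rw [Nat.pos_iff_ne_zero]
    intro h
    have := (le_max_left _ _).trans_lt (hN2 k)
    rw [h, Nat.cast_zero, div_zero] at this
    exact lt_irrefl _ this
  refine ⟨N, tendsto_atTop_mono hN1 tendsto_id, hpos, fun η hη => ?_⟩
  have hlim := (tendsto_one_div_add_atTop_nhds_zero_nat (𝕜 := ℝ)).eventually (gt_mem_nhds hη)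
  filter_upwards [hlim] with k hk
  have h1 := (le_max_right _ _).trans_lt (hN2 k)
  have h2 : (0 : ℝ) < (F (N k)).card := by exact_mod_cast hpos k
  rw [lt_div_iff₀ h2] at h1
  nlinarith

/-- A set whose pair correlations in initial segments are dominated by those of `E` along a
Følner sequence, and whose density is at least that of `E`. -/
theorem IsFolner.exists_range_upperDensity {F : ℕ → Finset ℕ} (hF : IsFolner F) (E : Set ℕ)
    (hE : 0 < upperDensity F E) :
    ∃ E' : Set ℕ, upperDensity F E ≤ upperDensity (fun N => Finset.range N) E' ∧
      ∀ r : ℕ, upperDensity (fun N => Finset.range N) (E' ∩ {m : ℕ | m + r ∈ E'}) ≤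
        upperDensity F (E ∩ {m : ℕ | m + r ∈ E}) := by
  obtain ⟨N, hN, hpos, hdens⟩ := exists_subseq_upperDensity F E hE
  obtain ⟨κ, hκ, hκg⟩ := exists_tendsto_atTop_comp_le fun k => (k + 1) * (F (N k)).card
  set G : ℕ → Finset ℕ := fun j => F (N (κ j)) with hG
  have hGpos : ∀ j, 0 < (G j).card := fun j => hpos _
  have hNκ : Tendsto (fun j => N (κ j)) atTop atTop := hN.comp hκ
  have hsmall : ∀ η : ℝ, 0 < η → ∀ᶠ j : ℕ in atTop, ((G j).card : ℝ) ≤ η * j := by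
    intro η hη
    obtain ⟨K, hK⟩ := exists_nat_ge (1 / η)
    filter_upwards [hκg, hκ.eventually_ge_atTop K] with j h1 h2
    have h3 : ((κ j : ℝ) + 1) * (G j).card ≤ j := by exact_mod_cast h1
    have h4 : (K : ℝ) ≤ κ j := by exact_mod_cast h2
    rw [div_le_iff₀ hη] at hK
    have h5 : 1 ≤ η * ((κ j : ℝ) + 1) := by nlinarith
    calc ((G j).card : ℝ) ≤ (η * ((κ j : ℝ) + 1)) * (G j).card :=
          le_mul_of_one_le_left (by positivity) h5
      _ = η * (((κ j : ℝ) + 1) * (G j).card) := by ring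
      _ ≤ η * j := mul_le_mul_of_nonneg_left h3 hη.le
  obtain ⟨x, hx⟩ := exists_concat_enumeration G hGpos
  have transfer : ∀ (A : Set ℕ) (c : ℝ), 0 ≤ c →
      (∀ᶠ j in atTop, ((G j).countIn A : ℝ) ≤ c * (G j).card) →
      ∀ η : ℝ, 0 < η → ∀ᶠ n : ℕ in atTop,
        ((Finset.range n).countIn {m : ℕ | x m ∈ A} : ℝ) ≤ (c + η) * n := by
    intro A c hc hA η hη
    refine eventually_countIn_range_le_of_blocks hGpos hsmall _ hc ?_ hη
    filter_upwards [hA] with j hj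
    rw [← (hx j).1 A] at hj
    exact hj
  have hjump : ∀ η : ℝ, 0 < η → ∀ᶠ n : ℕ in atTop,
      ((Finset.range n).countIn {m : ℕ | x (m + 1) ≠ x m + 1} : ℝ) ≤ η * n := by
    intro η hη
    have h := eventually_countIn_range_le_of_blocks hGpos hsmall
      {m : ℕ | x (m + 1) ≠ x m + 1} (half_pos hη).le ?_ (half_pos hη)
    · simpa only [add_halves] using h
    · filter_upwards [hNκ.eventually ((hF 1).eventually (gt_mem_nhds (half_pos hη)))] with j hj
      have h2 : (0 : ℝ) < (G j).card := by exact_mod_cast hGpos j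
      rw [div_lt_iff₀ h2] at hj
      refine le_trans ?_ hj.le
      have h3 := (hx j).1 {n : ℕ | n + 1 ∉ G j}
      have h4 := countIn_succ_notMem_le (G j)
      rw [← h3] at h4
      refine Nat.cast_le.2 (le_trans (Finset.countIn_le_countIn fun m hm1 hm2 => ?_) h4)
      exact fun h => hm2 ((hx j).2 m hm1 h)
  refine ⟨{m | x m ∈ E}, ?_, fun r => ?_⟩
  · refine le_of_forall_pos_le_add fun η hη => ?_
    rw [← sub_le_iff_le_add]
    refine le_limsup_of_frequently_le (Eventually.frequently ?_)
      (isBoundedUnder_le_density_ratio _ _)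
    have hδ : upperDensity F E ≤ 1 :=
      limsup_le_of_le (isBoundedUnder_ge_density_ratio F E).isCoboundedUnder_le
        (Eventually.of_forall fun N => (density_ratio_mem_Icc (F N) E).2)
    have hcompl := transfer Eᶜ (1 - upperDensity F E + η / 2) (by linarith) ?_ (η / 2) (half_pos hη)
    · filter_upwards [hcompl, eventually_gt_atTop 0] with n h1 h2
      have h3 : (0 : ℝ) < (Finset.range n).card := by
        rw [Finset.card_range]; exact_mod_cast h2
      change _ ≤ ((Finset.range n).countIn {m | x m ∈ E} : ℝ) / _
      rw [le_div_iff₀ h3, Finset.card_range]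
      have h4 := (Finset.range n).countIn_add_countIn_compl {m | x m ∈ E}
      rw [Finset.card_range] at h4
      have h5 : ((Finset.range n).countIn {m | x m ∈ E} : ℝ) +
        (Finset.range n).countIn {m | x m ∈ Eᶜ} = n := by exact_mod_cast h4
      linarith
    · filter_upwards [hκ.eventually (hdens (η / 2) (half_pos hη))] with j hj
      have h4 := (G j).countIn_add_countIn_compl E
      have h5 : ((G j).countIn E : ℝ) + (G j).countIn Eᶜ =
        (G j).card := by exact_mod_cast h4
      have h6 : (upperDensity F E - η / 2) * (G j).card ≤ (G j).countIn E := hj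
      linarith
  · refine le_of_forall_pos_le_add fun η hη => ?_
    refine limsup_le_of_le (isBoundedUnder_ge_density_ratio _ _).isCoboundedUnder_le ?_
    have hcorr := transfer (E ∩ {m : ℕ | m + r ∈ E})
      (upperDensity F (E ∩ {m : ℕ | m + r ∈ E}) + η / 3)
      (add_nonneg (upperDensity_nonneg _ _) (by positivity)) ?_ (η / 3) (by positivity)
    · filter_upwards [hcorr, eventually_countIn_add_ne_le hjump r (η / 3) (by positivity),
        eventually_gt_atTop 0] with n h1 h2 h3
      have h4 : (0 : ℝ) < (Finset.range n).card := by
        rw [Finset.card_range]; exact_mod_cast h3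
      change ((Finset.range n).countIn
        ({m | x m ∈ E} ∩ {m : ℕ | m + r ∈ {m | x m ∈ E}}) : ℝ) / _ ≤ _
      rw [div_le_iff₀ h4, Finset.card_range]
      have h5 : ((Finset.range n).countIn
            ({m | x m ∈ E} ∩ {m : ℕ | m + r ∈ {m | x m ∈ E}}) : ℝ) ≤
          (Finset.range n).countIn {m : ℕ | x m ∈ E ∩ {m : ℕ | m + r ∈ E}} +
            (Finset.range n).countIn {m : ℕ | x (m + r) ≠ x m + r} := by
        refine mod_cast Finset.countIn_le_add fun m _ hm => ?_
        by_cases hxm : x (m + r) = x m + r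
        · have hm2 : x (m + r) ∈ E := hm.2
          rw [hxm] at hm2
          exact Or.inl ⟨hm.1, hm2⟩
        · exact Or.inr hxm
      refine h5.trans ?_
      linarith
    · have hlt : upperDensity F (E ∩ {m : ℕ | m + r ∈ E}) <
          upperDensity F (E ∩ {m : ℕ | m + r ∈ E}) + η / 3 := by linarith
      have := eventually_lt_of_limsup_lt hlt (isBoundedUnder_le_density_ratio F _)
      filter_upwards [hNκ.eventually this] with j hj
      have h2 : (0 : ℝ) < (G j).card := by exact_mod_cast hGpos j
      rw [div_lt_iff₀ h2] at hj
      exact hj.le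

/-- If `R` is `({0, …, N-1})`-nicely intersective then it is `(F_N)`-nicely intersective
for every Følner sequence `(F_N)`. -/
theorem nicelyIntersective_range_forall (R : Set ℕ)
    (hR : NicelyIntersective (fun N => Finset.range N) R)
    (F : ℕ → Finset ℕ) (hF : IsFolner F) : NicelyIntersective F R := by
  intro E ε hε
  rcases (upperDensity_nonneg F E).eq_or_lt with hE | hE
  · obtain ⟨r, hrR, hr, -⟩ := hR E ε hε
    refine ⟨r, hrR, hr, ?_⟩
    have := upperDensity_nonneg F (E ∩ {m : ℕ | m + r ∈ E})
    rw [← hE]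
    linarith
  · obtain ⟨E', hE', hcorr⟩ := hF.exists_range_upperDensity E hE
    obtain ⟨r, hrR, hr, hlt⟩ := hR E' ε hε
    refine ⟨r, hrR, hr, ?_⟩
    have h1 := hcorr r
    have h2 := pow_le_pow_left₀ hE.le hE' 2
    linarith
end

section
/- Furstenberg's correspondence principle: given any set E ⊆ ℕ and any Følner sequence (F_N) in ℕ, there exist a measure preserving system (X, μ, T), a measurable set A ⊆ X with μ(A) = d̄_{(F_N)}(E), and a strictly increasing sequence (N_i) of indices, such that for all k ≥ 1 and all n₁, …, n_k ∈ ℕ, the limit lim_{i→∞} |(E − n₁) ∩ … ∩ (E − n_k) ∩ F_{N_i}| / |F_{N_i}| exists and equals μ(T^{−n₁}A ∩ … ∩ T^{−n_k}A). -/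
open MeasureTheory Filter
open scoped Classical symmDiff

/-- The left shift on sequences. -/
def shift {α : Type*} (x : ℕ → α) : ℕ → α := fun i => x (i + 1)

theorem continuous_shift {α : Type*} [TopologicalSpace α] :
    Continuous (shift : (ℕ → α) → ℕ → α) :=
  continuous_pi fun i => continuous_apply (i + 1)

theorem shift_iterate_apply {α : Type*} (n : ℕ) (x : ℕ → α) (i : ℕ) :
    shift^[n] x i = x (i + n) := by
  induction n generalizing x with
  | zero => rfl
  | succ n ih => rw [Function.iterate_succ_apply, ih, shift, Nat.add_assoc]

/-- The indicator sequence of `E - m`, which is the `m`-th shift of the indicator of `E`. -/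
noncomputable def indicatorOrbit (E : Set ℕ) (m : ℕ) : ℕ → Bool := fun i => decide (m + i ∈ E)

theorem shift_indicatorOrbit (E : Set ℕ) (m : ℕ) :
    shift (indicatorOrbit E m) = indicatorOrbit E (m + 1) := by
  funext i
  simp [shift, indicatorOrbit, Nat.add_comm, Nat.add_left_comm]

/-- The uniform average of point masses at `x m`, `m ∈ S`; a point mass at `y` if `S = ∅`. -/
noncomputable def empiricalMeasure {Y : Type*} [MeasurableSpace Y] (S : Finset ℕ) (x : ℕ → Y)
    (y : Y) : ProbabilityMeasure Y where
  val := if S.Nonempty then (ProbabilityTheory.uniformOn (S : Set ℕ)).map x else Measure.dirac y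
  property := by
    split_ifs with h
    · have := ProbabilityTheory.isProbabilityMeasure_uniformOn S.finite_toSet h
      exact Measure.isProbabilityMeasure_map (measurable_of_countable x).aemeasurable
    · infer_instance

theorem empiricalMeasure_of_nonempty {Y : Type*} [MeasurableSpace Y] {S : Finset ℕ}
    (hS : S.Nonempty) (x : ℕ → Y) (y : Y) :
    (empiricalMeasure S x y : Measure Y) = (ProbabilityTheory.uniformOn (S : Set ℕ)).map x :=
  if_pos hS

theorem empiricalMeasure_of_not_nonempty {Y : Type*} [MeasurableSpace Y] {S : Finset ℕ}
    (hS : ¬S.Nonempty) (x : ℕ → Y) (y : Y) :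
    (empiricalMeasure S x y : Measure Y) = Measure.dirac y :=
  if_neg hS

theorem empiricalMeasure_apply {Y : Type*} [MeasurableSpace Y] {S : Finset ℕ} (hS : S.Nonempty)
    (x : ℕ → Y) (y : Y) {C : Set Y} (hC : MeasurableSet C) :
    (empiricalMeasure S x y : Measure Y).real C
      = ((S.filter (fun m => x m ∈ C)).card : ℝ) / S.card := by
  have h : (S : Set ℕ) ∩ x ⁻¹' C = (S.filter (fun m => x m ∈ C) : Finset ℕ) := by
    ext m; simp
  rw [measureReal_def, empiricalMeasure_of_nonempty hS, Measure.map_apply (measurable_of_countable x) hC,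
    ← ProbabilityTheory.uniformOn_inter_self S.finite_toSet, h,
    ProbabilityTheory.uniformOn_apply_finset,
    Finset.inter_eq_right.2 (Finset.filter_subset _ _)]
  simp

theorem card_filter_le_add_card_symmDiff {α : Type*} [DecidableEq α] (A B : Finset α)
    (P : α → Prop) :
    (A.filter P).card ≤ (B.filter P).card + (A ∆ B).card := by
  refine (Finset.card_le_card fun a ha => ?_).trans (Finset.card_union_le _ _)
  simp only [Finset.mem_union, Finset.mem_filter, Finset.mem_symmDiff] at ha ⊢
  tauto

theorem abs_card_filter_succ_sub_le (S : Finset ℕ) (P : ℕ → Prop) :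
    |((S.filter (fun m => P (m + 1))).card : ℝ) - (S.filter P).card|
      ≤ (S ∆ S.image (· + 1)).card := by
  have h : (S.filter (fun m => P (m + 1))).card = ((S.image (· + 1)).filter P).card := by
    rw [Finset.filter_image, Finset.card_image_of_injective _ (add_left_injective 1)]
  have h₁ := card_filter_le_add_card_symmDiff S (S.image (· + 1)) P
  have h₂ := card_filter_le_add_card_symmDiff (S.image (· + 1)) S P
  rw [symmDiff_comm] at h₂
  rw [h, abs_sub_le_iff, sub_le_iff_le_add', sub_le_iff_le_add']
  exact ⟨by exact_mod_cast h₂, by exact_mod_cast h₁⟩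

theorem abs_empiricalMeasure_preimage_sub_le {Y : Type*} [MeasurableSpace Y] {T : Y → Y}
    (hT : Measurable T) {x : ℕ → Y} (hx : ∀ m, T (x m) = x (m + 1)) {y : Y} (hy : T y = y)
    (S : Finset ℕ) {C : Set Y} (hC : MeasurableSet C) :
    |(empiricalMeasure S x y : Measure Y).real (T ⁻¹' C)
        - (empiricalMeasure S x y : Measure Y).real C|
      ≤ ((S ∆ S.image (· + 1)).card : ℝ) / S.card := by
  rcases S.eq_empty_or_nonempty with rfl | hS
  · have h : Measure.dirac y (T ⁻¹' C) = Measure.dirac y C := by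
      rw [Measure.dirac_apply' _ (hT hC), Measure.dirac_apply' _ hC]
      simp [Set.indicator, hy]
    simp [empiricalMeasure_of_not_nonempty, measureReal_def, h]
  · rw [empiricalMeasure_apply hS x y (hT hC), empiricalMeasure_apply hS x y hC, ← sub_div,
      abs_div, Nat.abs_cast]
    gcongr
    simpa only [Set.mem_preimage, hx] using abs_card_filter_succ_sub_le S (fun m => x m ∈ C)

theorem tendsto_measureReal_of_isClopen {Y ι : Type*} [MeasurableSpace Y] [TopologicalSpace Y]
    [OpensMeasurableSpace Y] [HasOuterApproxClosed Y] {l : Filter ι} {μ : ProbabilityMeasure Y}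
    {ν : ι → ProbabilityMeasure Y} (h : Tendsto ν l (nhds μ)) {C : Set Y} (hC : IsClopen C) :
    Tendsto (fun i => (ν i : Measure Y).real C) l (nhds ((μ : Measure Y).real C)) :=
  (NNReal.continuous_coe.tendsto _).comp
    (ProbabilityMeasure.tendsto_measure_of_isClopen_of_tendsto h hC)

theorem isClopen_of_mem_measurableCylinders {ι : Type*} {α : ι → Type*}
    [∀ i, MeasurableSpace (α i)] [∀ i, TopologicalSpace (α i)] [∀ i, DiscreteTopology (α i)]
    {C : Set (∀ i, α i)} (hC : C ∈ measurableCylinders α) : IsClopen C := by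
  obtain ⟨s, S, -, rfl⟩ := (mem_measurableCylinders C).1 hC
  exact (isClopen_discrete S).preimage (by fun_prop)

/-- A weak limit of probability measures on a sequence space that are asymptotically shift
invariant on cylinders is shift invariant. -/
theorem measurePreserving_shift_of_tendsto {ν : ℕ → ProbabilityMeasure (ℕ → Bool)}
    {μ : ProbabilityMeasure (ℕ → Bool)} (h : Tendsto ν atTop (nhds μ))
    (hν : ∀ C : Set (ℕ → Bool), IsClopen C →
      Tendsto (fun i => (ν i : Measure (ℕ → Bool)).real (shift ⁻¹' C)
        - (ν i : Measure (ℕ → Bool)).real C) atTop (nhds 0)) :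
    MeasurePreserving shift (μ : Measure (ℕ → Bool)) μ := by
  have hm : Measurable (shift : (ℕ → Bool) → ℕ → Bool) := continuous_shift.measurable
  refine ⟨hm, ?_⟩
  have : IsProbabilityMeasure ((μ : Measure (ℕ → Bool)).map shift) :=
    Measure.isProbabilityMeasure_map hm.aemeasurable
  refine ext_of_generate_finite (measurableCylinders fun _ : ℕ => Bool)
    generateFrom_measurableCylinders.symm isPiSystem_measurableCylinders (fun C hC => ?_)
    (by simp)
  have hC' := isClopen_of_mem_measurableCylinders hC
  have key := tendsto_nhds_unique (hν C hC')
    ((tendsto_measureReal_of_isClopen h (hC'.preimage continuous_shift)).sub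
      (tendsto_measureReal_of_isClopen h hC'))
  rw [Measure.map_apply hm (.of_mem_measurableCylinders hC)]
  exact (measureReal_eq_measureReal_iff).1 (sub_eq_zero.1 key.symm)

theorem exists_strictMono_tendsto_upperDensity (F : ℕ → Finset ℕ) (E : Set ℕ) :
    ∃ φ : ℕ → ℕ, StrictMono φ ∧
      Tendsto (fun i => (((F (φ i)).filter (· ∈ E)).card : ℝ) / (F (φ i)).card) atTop
        (nhds (upperDensity F E)) := by
  have h₀ : IsBoundedUnder (· ≥ ·) atTop
      (fun N : ℕ => (((F N).filter (· ∈ E)).card : ℝ) / (F N).card) :=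
    isBoundedUnder_of ⟨0, fun N => by positivity⟩
  have h₁ : IsBoundedUnder (· ≤ ·) atTop
      (fun N : ℕ => (((F N).filter (· ∈ E)).card : ℝ) / (F N).card) :=
    isBoundedUnder_of ⟨1, fun N => div_le_one_of_le₀
      (by exact_mod_cast Finset.card_filter_le _ _) (by positivity)⟩
  exact (MapClusterPt.limsup h₀.isCoboundedUnder_le h₁).tendsto_subseq

theorem isClopen_setOf_forall_apply_eq_true {k : ℕ} (n : Fin k → ℕ) :
    IsClopen {x : ℕ → Bool | ∀ j, x (n j) = true} := by
  rw [Set.ofPred_forall]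
  exact isClopen_iInter_of_finite fun j =>
    (isClopen_discrete {true}).preimage (continuous_apply (n j))

theorem empiricalMeasure_indicatorOrbit_apply (E : Set ℕ) (S : Finset ℕ) {k : ℕ} (hk : 1 ≤ k)
    (n : Fin k → ℕ) :
    (empiricalMeasure S (indicatorOrbit E) (fun _ => false) : Measure (ℕ → Bool)).real
        {x | ∀ j, x (n j) = true}
      = ((S.filter (fun m => ∀ j, m + n j ∈ E)).card : ℝ) / S.card := by
  have hC := (isClopen_setOf_forall_apply_eq_true n).isOpen.measurableSet
  rcases S.eq_empty_or_nonempty with rfl | hS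
  · have : Nonempty (Fin k) := ⟨⟨0, hk⟩⟩
    simp [empiricalMeasure_of_not_nonempty, measureReal_def, Measure.dirac_apply' _ hC]
  · rw [empiricalMeasure_apply hS _ _ hC]
    simp [indicatorOrbit]

/-- Furstenberg's correspondence principle: for any `E ⊆ ℕ` and any Følner sequence `(F_N)`
there is a measure preserving system `(X, μ, T)`, a measurable `A ⊆ X` with
`μ(A) = d̄_{(F_N)}(E)`, and a strictly increasing sequence of indices `(N_i)` along which
the density of `(E - n₁) ∩ ⋯ ∩ (E - n_k)` exists and equals
`μ(T^{-n₁}A ∩ ⋯ ∩ T^{-n_k}A)` for all `k ≥ 1` and `n₁, …, n_k ∈ ℕ`. -/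
theorem furstenberg_correspondence (E : Set ℕ) (F : ℕ → Finset ℕ) (hF : IsFolner F) :
    ∃ (X : Type) (_ : MeasurableSpace X) (μ : Measure X) (T : X → X) (A : Set X)
      (Ni : ℕ → ℕ),
      IsProbabilityMeasure μ ∧ Measurable T ∧ MeasurePreserving T μ μ ∧
      MeasurableSet A ∧ (μ A).toReal = upperDensity F E ∧ StrictMono Ni ∧
      ∀ (k : ℕ), 1 ≤ k → ∀ n : Fin k → ℕ,
        Tendsto
          (fun i : ℕ =>
            (((F (Ni i)).filter (fun m => ∀ j : Fin k, m + n j ∈ E)).card : ℝ) /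
              (F (Ni i)).card)
          atTop
          (nhds ((μ (⋂ j : Fin k, T^[n j] ⁻¹' A)).toReal)) := by
  obtain ⟨φ, hφ, hφE⟩ := exists_strictMono_tendsto_upperDensity F E
  obtain ⟨μ, ψ, hψ, hμ⟩ := CompactSpace.tendsto_subseq
    (fun i => empiricalMeasure (F (φ i)) (indicatorOrbit E) (fun _ => false))
  have hφψ : StrictMono (φ ∘ ψ) := hφ.comp hψ
  have hlim : ∀ k : ℕ, 1 ≤ k → ∀ n : Fin k → ℕ,
      Tendsto (fun i => (((F (φ (ψ i))).filter (fun m => ∀ j, m + n j ∈ E)).card : ℝ) /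
        (F (φ (ψ i))).card) atTop
        (nhds ((μ : Measure (ℕ → Bool)).real {x | ∀ j, x (n j) = true})) := fun k hk n => by
    simpa only [Function.comp_apply, empiricalMeasure_indicatorOrbit_apply E _ hk n] using
      tendsto_measureReal_of_isClopen hμ (isClopen_setOf_forall_apply_eq_true n)
  have hpres : MeasurePreserving shift (μ : Measure (ℕ → Bool)) μ := by
    refine measurePreserving_shift_of_tendsto hμ fun C hC => ?_
    refine squeeze_zero_norm (fun i => ?_) ((hF 1).comp hφψ.tendsto_atTop)
    exact abs_empiricalMeasure_preimage_sub_le continuous_shift.measurable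
      (shift_indicatorOrbit E) rfl _ hC.isOpen.measurableSet
  refine ⟨ℕ → Bool, inferInstance, μ, shift, {x | x 0 = true}, φ ∘ ψ, inferInstance,
    hpres.measurable, hpres, ?_, ?_, hφψ, fun k hk n => ?_⟩
  · simpa using (isClopen_setOf_forall_apply_eq_true (fun _ : Fin 1 => 0)).isOpen.measurableSet
  · refine tendsto_nhds_unique ?_ (hφE.comp hψ.tendsto_atTop)
    simpa [measureReal_def, Function.comp_def] using hlim 1 le_rfl (fun _ => 0)
  · have h : (⋂ j, shift^[n j] ⁻¹' {x : ℕ → Bool | x 0 = true})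
        = {x | ∀ j, x (n j) = true} := by
      ext x
      simp [shift_iterate_apply]
    rw [h]
    exact hlim k hk n
end

section
/- Uniformity of nice recurrence: let R ⊆ ℕ be a set of nice recurrence. Then for all δ > 0 and ε > 0 there exists a positive integer N₀ such that for every measure preserving system (X, μ, T) and every measurable set A ⊆ X with μ(A) ≥ δ, there exists r ∈ R with 1 ≤ r ≤ N₀ and μ(A ∩ T^{−r}A) > δ² − ε. -/
open MeasureTheory Filter
open scoped Classical symmDiff

/-- The left shift on the space of binary sequences. -/
def binaryShift (y : ℕ → Bool) : ℕ → Bool := fun n => y (n + 1)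

/-- The cylinder of binary sequences that start with `true`. -/
def trueCylinder : Set (ℕ → Bool) := {y | y 0 = true}

lemma continuous_binaryShift : Continuous binaryShift :=
  continuous_pi fun n => continuous_apply (n + 1)

lemma isClopen_trueCylinder : IsClopen trueCylinder :=
  (isClopen_discrete ({true} : Set Bool)).preimage (continuous_apply 0)

lemma isClopen_trueCylinder_return (r : ℕ) :
    IsClopen (trueCylinder ∩ binaryShift^[r] ⁻¹' trueCylinder) :=
  isClopen_trueCylinder.inter
    (isClopen_trueCylinder.preimage (continuous_binaryShift.iterate r))

/-- Every measure preserving system with a marked set has a symbolic model: a shift invariant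
probability measure on binary sequences with the same return measures. -/
lemma exists_shift_invariant_model {X : Type*} [MeasurableSpace X] {μ : Measure X} {T : X → X}
    [IsProbabilityMeasure μ] (hT : MeasurePreserving T μ μ) {A : Set X} (hA : MeasurableSet A) :
    ∃ ν : ProbabilityMeasure (ℕ → Bool),
      ν.map continuous_binaryShift.aemeasurable = ν ∧
      ∀ r : ℕ, (ν : Measure (ℕ → Bool)) (trueCylinder ∩ binaryShift^[r] ⁻¹' trueCylinder) =
        μ (A ∩ T^[r] ⁻¹' A) := by
  let φ : X → ℕ → Bool := fun x n => decide (T^[n] x ∈ A)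
  have hφ : Measurable φ := by
    refine measurable_pi_lambda _ fun n => measurable_to_bool ?_
    have : (fun x => φ x n) ⁻¹' {true} = T^[n] ⁻¹' A := by
      ext x
      simp [φ]
    rw [this]
    exact (hT.measurable.iterate n) hA
  have hshift : Function.Semiconj φ T binaryShift := fun x => by
    funext n
    exact decide_eq_decide.2 (by rw [← Function.iterate_succ_apply])
  refine ⟨⟨μ.map φ, Measure.isProbabilityMeasure_map hφ.aemeasurable⟩, ?_, fun r => ?_⟩
  · apply Subtype.ext
    change (μ.map φ).map binaryShift = μ.map φ
    rw [Measure.map_map continuous_binaryShift.measurable hφ, ← hshift.comp_eq,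
      ← Measure.map_map hφ hT.measurable, hT.map_eq]
  · change μ.map φ _ = _
    rw [Measure.map_apply hφ (isClopen_trueCylinder_return r).isOpen.measurableSet]
    congr 1
    ext x
    have hr : binaryShift^[r] (φ x) = φ (T^[r] x) := ((hshift.iterate_right r) x).symm
    simp only [Set.mem_preimage, Set.mem_inter_iff, hr]
    exact and_congr decide_eq_true_iff decide_eq_true_iff

/-- Uniformity of nice recurrence: if `R` is a set of nice recurrence then for all
`δ, ε > 0` there exists `N₀ ≥ 1` such that every measure preserving system `(X, μ, T)` and
measurable `A` with `μ(A) ≥ δ` satisfies `μ(A ∩ T^{-r}A) > δ² - ε` for some `r ∈ R` with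
`1 ≤ r ≤ N₀`. -/
theorem uniformity_of_nice_recurrence (R : Set ℕ) (hR : IsNiceRecurrenceSet R)
    (δ ε : ℝ) (hδ : 0 < δ) (hε : 0 < ε) :
    ∃ N₀ : ℕ, 1 ≤ N₀ ∧
      ∀ (X : Type) (_ : MeasurableSpace X) (μ : Measure X) (T : X → X),
        IsProbabilityMeasure μ → Measurable T → MeasurePreserving T μ μ →
        ∀ A : Set X, MeasurableSet A → δ ≤ (μ A).toReal →
          ∃ r ∈ R, 1 ≤ r ∧ r ≤ N₀ ∧ (μ (A ∩ T^[r] ⁻¹' A)).toReal > δ ^ 2 - ε := by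
  by_contra! hcon
  have hmodel : ∀ N : ℕ, ∃ ν : ProbabilityMeasure (ℕ → Bool),
      ν.map continuous_binaryShift.aemeasurable = ν ∧
      δ ≤ ((ν : Measure (ℕ → Bool))
        (trueCylinder ∩ binaryShift^[0] ⁻¹' trueCylinder)).toReal ∧
      ∀ r ∈ R, 1 ≤ r → r ≤ N + 1 → ((ν : Measure (ℕ → Bool))
        (trueCylinder ∩ binaryShift^[r] ⁻¹' trueCylinder)).toReal ≤ δ ^ 2 - ε := by
    intro N
    obtain ⟨X, _, μ, T, _, -, hT, A, hA, hδA, hret⟩ := hcon (N + 1) (by omega)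
    obtain ⟨ν, hinv, hν⟩ := exists_shift_invariant_model hT hA
    refine ⟨ν, hinv, ?_, fun r hr h1 hN => ?_⟩
    · rw [hν]
      simpa using hδA
    · rw [hν]
      exact hret r hr h1 hN
  choose ν hinv hδν hret using hmodel
  obtain ⟨κ, -, hκ⟩ := isCompact_univ.ultrafilter_le_nhds
    ((hyperfilter ℕ).map ν) (by simp)
  have hlim : Tendsto ν (hyperfilter ℕ) (nhds κ) := hκ
  have hκinv : κ.map continuous_binaryShift.aemeasurable = κ := by
    have h := ProbabilityMeasure.tendsto_map_of_tendsto_of_continuous ν κ hlim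
      continuous_binaryShift
    simp only [hinv] at h
    exact tendsto_nhds_unique h hlim
  have hκpres : MeasurePreserving binaryShift (κ : Measure (ℕ → Bool)) κ :=
    ⟨continuous_binaryShift.measurable, congrArg Subtype.val hκinv⟩
  have hκlim (r : ℕ) : Tendsto (fun N => ((ν N : Measure (ℕ → Bool))
        (trueCylinder ∩ binaryShift^[r] ⁻¹' trueCylinder)).toReal) (hyperfilter ℕ)
      (nhds ((κ : Measure (ℕ → Bool))
        (trueCylinder ∩ binaryShift^[r] ⁻¹' trueCylinder)).toReal) :=
    (NNReal.tendsto_coe.2 (ProbabilityMeasure.tendsto_measure_of_isClopen_of_tendsto hlim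
      (isClopen_trueCylinder_return r)))
  have hδκ : δ ≤ ((κ : Measure (ℕ → Bool)) trueCylinder).toReal := by
    simpa using ge_of_tendsto (hκlim 0) (Eventually.of_forall hδν)
  obtain ⟨r, hrR, hr0, hr⟩ := hR (ℕ → Bool) inferInstance κ binaryShift inferInstance
    continuous_binaryShift.measurable hκpres trueCylinder
    isClopen_trueCylinder.isOpen.measurableSet ε hε
  have hupper : ((κ : Measure (ℕ → Bool))
      (trueCylinder ∩ binaryShift^[r] ⁻¹' trueCylinder)).toReal ≤ δ ^ 2 - ε := by
    refine le_of_tendsto (hκlim r) ?_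
    have hev : ∀ᶠ N in (hyperfilter ℕ : Filter ℕ), r ≤ N :=
      (Nat.hyperfilter_le_atTop) (eventually_ge_atTop r)
    filter_upwards [hev] with N hN
    exact hret N r hrR (by omega) (by omega)
  nlinarith
end

section
/- Let ν be a shift-invariant Borel probability measure on {0,1}^ℕ. For every k ∈ ℕ and every ε > 0 there exist a point x ∈ {0,1}^ℕ and a positive integer R₀ such that for all R ≥ R₀ and every y ∈ {0,1}^ℕ whose first R coordinates agree with those of x (i.e. y_i = x_i for 0 ≤ i ≤ R−1), one has |(1/R) · #{ 0 ≤ i ≤ R−1 : σ^i(y) ∈ C } − ν(C)| < ε for every cylinder C with domain contained in {0, 1, …, k−1}. -/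
open MeasureTheory Filter
open scoped Classical

/-- The left shift on `{0,1}^ℕ` (modelled as `ℕ → Bool`). -/
def binShift : (ℕ → Bool) → (ℕ → Bool) := fun ω n => ω (n + 1)

theorem binShift_iterate_apply (i : ℕ) (ω : ℕ → Bool) (n : ℕ) :
    binShift^[i] ω n = ω (n + i) := by
  induction i generalizing ω with
  | zero => rfl
  | succ i ih =>
    rw [Function.iterate_succ_apply, ih]
    simp [binShift, add_assoc]

/-- By the strong law of large numbers, some sequence of points has empirical averages converging
to the integrals of countably many given integrable functions. -/
theorem exists_seq_tendsto_average {Ω ι : Type*} [MeasurableSpace Ω] [Countable ι]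
    (μ : Measure Ω) [IsProbabilityMeasure μ] (f : ι → Ω → ℝ) (hm : ∀ i, Measurable (f i))
    (hf : ∀ i, Integrable (f i) μ) :
    ∃ ω : ℕ → Ω, ∀ i, Tendsto (fun m : ℕ => (∑ j ∈ Finset.range m, f i (ω j)) / m) atTop
      (nhds (∫ a, f i a ∂μ)) := by
  let P : Measure (ℕ → Ω) := Measure.infinitePi fun _ => μ
  have hmap (j : ℕ) : MeasurePreserving (fun ω : ℕ → Ω => ω j) P μ :=
    measurePreserving_eval_infinitePi (fun _ => μ) j
  have hlaw : ∀ᵐ ω ∂P, ∀ i, Tendsto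
      (fun m : ℕ => (∑ j ∈ Finset.range m, f i (ω j)) / m) atTop
      (nhds (∫ a, f i a ∂μ)) := by
    refine ae_all_iff.2 fun i => ?_
    have hindep : ProbabilityTheory.iIndepFun (fun j (ω : ℕ → Ω) => f i (ω j)) P :=
      ProbabilityTheory.iIndepFun_infinitePi (P := fun _ : ℕ => μ)
        (X := fun _ : ℕ => f i) (fun _ => hm i)
    have hident (j : ℕ) : ProbabilityTheory.IdentDistrib (fun ω : ℕ → Ω => f i (ω j))
        (fun ω => f i (ω 0)) P P :=
      ⟨((hm i).comp (measurable_pi_apply j)).aemeasurable,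
        ((hm i).comp (measurable_pi_apply 0)).aemeasurable,
        (((hm i).measurePreserving μ).comp (hmap j)).map_eq.trans
          (((hm i).measurePreserving μ).comp (hmap 0)).map_eq.symm⟩
    have h := ProbabilityTheory.strong_law_ae_real (fun j (ω : ℕ → Ω) => f i (ω j))
      ((hmap 0).integrable_comp_of_integrable (hf i))
      (fun a b hab => hindep.indepFun hab) hident
    have hint : ∫ ω, f i (ω 0) ∂P = ∫ a, f i a ∂μ := by
      rw [← (hmap 0).map_eq, integral_map (hmap 0).aemeasurable (hm i).aestronglyMeasurable]
    rwa [hint] at h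
  exact hlaw.exists

/-- If every length-`N` block of `g` agrees with `F` except possibly at its last `k` places, then
the sums over the first `m` blocks differ by at most `m * k`. -/
theorem abs_sum_range_mul_sub_le (g : ℕ → ℝ) (F : ℕ → ℕ → ℝ) (N k m : ℕ) (hk : k ≤ N)
    (hd : ∀ i j t, |g i - F j t| ≤ 1)
    (h : ∀ j < m, ∀ t, t + k < N + 1 → g (N * j + t) = F j t) :
    |∑ i ∈ Finset.range (N * m), g i -
      ∑ j ∈ Finset.range m, ∑ t ∈ Finset.range N, F j t| ≤ m * k := by
  induction m with
  | zero => simp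
  | succ m ih =>
    have hblock : |∑ t ∈ Finset.range N, (g (N * m + t) - F m t)| ≤ k := by
      obtain ⟨n, rfl⟩ := Nat.exists_eq_add_of_le' hk
      rw [Finset.sum_range_add]
      rw [Finset.sum_eq_zero fun t ht => by
        rw [h m m.lt_succ_self t (by have := Finset.mem_range.1 ht; omega), sub_self], zero_add]
      refine (Finset.abs_sum_le_sum_abs _ _).trans ?_
      refine (Finset.sum_le_sum fun t _ => hd _ m (n + t)).trans (by simp)
    specialize ih fun j hj => h j (by omega)
    rw [mul_add_one, Finset.sum_range_add, Finset.sum_range_succ _ m]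
    rw [Finset.sum_sub_distrib] at hblock
    push_cast
    rw [abs_le] at *
    constructor <;> linarith [ih.1, ih.2, hblock.1, hblock.2]

/-- For every shift-invariant Borel probability measure `ν` on `{0,1}^ℕ`, every `k ∈ ℕ` and
`ε > 0`, there are `x ∈ {0,1}^ℕ` and `R₀ ≥ 1` such that for all `R ≥ R₀` and every `y`
agreeing with `x` on its first `R` coordinates, the empirical averages of `y` along
`{0, …, R-1}` are `ε`-close to `ν` on every cylinder with domain inside `{0, …, k-1}`. -/
theorem points_close_to_periodic (ν : Measure (ℕ → Bool)) [IsProbabilityMeasure ν]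
    (hν : MeasurePreserving binShift ν ν) (k : ℕ) (ε : ℝ) (hε : 0 < ε) :
    ∃ (x : ℕ → Bool) (R₀ : ℕ), 1 ≤ R₀ ∧
      ∀ R : ℕ, R₀ ≤ R → ∀ y : ℕ → Bool, (∀ i < R, y i = x i) →
        ∀ (r : ℕ) (n : Fin r → ℕ) (iv : Fin r → Bool), (∀ j : Fin r, n j < k) →
          |(((Finset.range R).filter
                (fun i => binShift^[i] y ∈ {ω : ℕ → Bool | ∀ j : Fin r, ω (n j) = iv j})).card : ℝ) / R -
              (ν {ω : ℕ → Bool | ∀ j : Fin r, ω (n j) = iv j}).toReal| < ε := by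
  let π : (ℕ → Bool) → (Fin k → Bool) := fun ω i => ω i
  have hπ : Measurable π := measurable_pi_lambda _ fun i => measurable_pi_apply _
  obtain ⟨N, hN⟩ := exists_nat_gt (4 * k / ε + k)
  have hdiv : 0 ≤ 4 * (k : ℝ) / ε := by positivity
  have hkN : k < N := by exact_mod_cast (by linarith : (k : ℝ) < N)
  have hNpos : (0 : ℝ) < N := by exact_mod_cast (by omega : 0 < N)
  have hkε : 4 * (k : ℝ) < ε * N := by
    have : 4 * (k : ℝ) / ε < N := by linarith [(Nat.cast_nonneg k : (0 : ℝ) ≤ k)]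
    rw [div_lt_iff₀ hε] at this
    linarith
  let χ : Set (Fin k → Bool) → (ℕ → Bool) → ℝ := fun A => (π ⁻¹' A).indicator 1
  have hχ (A) : Measurable (χ A) := measurable_one.indicator (hπ (Set.toFinite A).measurableSet)
  have hχ01 (A ω) : 0 ≤ χ A ω ∧ χ A ω ≤ 1 := by
    by_cases h : ω ∈ π ⁻¹' A <;> simp [χ, h]
  have hint (A) : Integrable (χ A) ν :=
    (integrable_const 1).indicator (hπ (Set.toFinite A).measurableSet)
  let f : Set (Fin k → Bool) → (ℕ → Bool) → ℝ :=
    fun A ω => ∑ t ∈ Finset.range N, χ A (binShift^[t] ω)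
  have hfi (A t) : Integrable (fun ω => χ A (binShift^[t] ω)) ν :=
    (hν.iterate t).integrable_comp_of_integrable (hint A)
  have hfint (A) : ∫ ω, f A ω ∂ν = N * ν.real (π ⁻¹' A) := by
    have (t : ℕ) : ∫ ω, χ A (binShift^[t] ω) ∂ν = ν.real (π ⁻¹' A) := by
      rw [← integral_map (hν.iterate t).aemeasurable (hχ A).aestronglyMeasurable,
        (hν.iterate t).map_eq]
      exact integral_indicator_one (hπ (Set.toFinite A).measurableSet)
    simp only [f]
    rw [integral_finsetSum _ fun t _ => hfi A t]
    simp [this]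
  obtain ⟨ω, hω⟩ := exists_seq_tendsto_average ν f
    (fun A => Finset.measurable_sum _ fun t _ => (hχ A).comp (hν.iterate t).measurable)
    (fun A => integrable_finsetSum _ fun t _ => hfi A t)
  have hev : ∀ᶠ m : ℕ in atTop, ∀ A,
      |(∑ j ∈ Finset.range m, f A (ω j)) / m - N * ν.real (π ⁻¹' A)| < N * ε / 4 := by
    refine eventually_all.2 fun A => ?_
    have h := hω A
    rw [hfint] at h
    exact (Metric.tendsto_nhds.1 h) _ (by positivity)
  obtain ⟨M, hM⟩ := eventually_atTop.1 hev
  obtain ⟨Q, hQ⟩ := exists_nat_gt (8 * N / ε)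
  rw [div_lt_iff₀ hε] at hQ
  refine ⟨fun n => ω (n / N) (n % N), N * (M + 1) + Q, by nlinarith, ?_⟩
  intro R hR y hy r n iv hn
  let A : Set (Fin k → Bool) := {v | ∀ j, v ⟨n j, hn j⟩ = iv j}
  have hcard : (((Finset.range R).filter
      (fun i => binShift^[i] y ∈ {ω : ℕ → Bool | ∀ j : Fin r, ω (n j) = iv j})).card : ℝ) =
      ∑ i ∈ Finset.range R, χ A (binShift^[i] y) := by
    simp [χ, π, A, Set.indicator_apply]
  rw [hcard]
  change |_ - ν.real (π ⁻¹' A)| < ε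
  obtain ⟨m, s, hs, rfl⟩ : ∃ m s, s < N ∧ R = N * m + s :=
    ⟨R / N, R % N, Nat.mod_lt _ (by omega), (Nat.div_add_mod R N).symm⟩
  have hMm : M + 1 ≤ m := by
    by_contra! hlt
    have := Nat.mul_le_mul_left N (Nat.le_of_lt_succ hlt)
    nlinarith
  have hblocks := abs_sum_range_mul_sub_le (fun i => χ A (binShift^[i] y))
    (fun j t => χ A (binShift^[t] (ω j))) N k m hkN.le
    (fun i j t => by
      have h1 := hχ01 A (binShift^[i] y)
      have h2 := hχ01 A (binShift^[t] (ω j))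
      rw [abs_le]
      constructor <;> linarith [h1.1, h1.2, h2.1, h2.2])
    (fun j hj t ht => by
      have hπeq : π (binShift^[N * j + t] y) = π (binShift^[t] (ω j)) := by
        funext a
        have ha := a.isLt
        have hle : N * j + N ≤ N * m := by
          rw [← mul_add_one]; exact Nat.mul_le_mul_left N hj
        have hpos : ↑a + (N * j + t) = (↑a + t) + N * j := by ring
        simp only [π, binShift_iterate_apply]
        rw [hy _ (by omega), hpos]
        beta_reduce
        rw [Nat.add_mul_div_left _ _ (by omega), Nat.add_mul_mod_self_left,
          Nat.div_eq_of_lt (by omega), Nat.mod_eq_of_lt (by omega), zero_add]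
      simp only [χ, Set.indicator_apply, Set.mem_preimage, hπeq, Pi.one_apply])
  have hmpos : (0 : ℝ) < m := by exact_mod_cast (by omega : 0 < m)
  have havg := hM m (by omega) A
  set D := ∑ j ∈ Finset.range m, f A (ω j)
  set c := ν.real (π ⁻¹' A)
  have hc0 : 0 ≤ c := measureReal_nonneg
  have hc1 : c ≤ 1 := measureReal_le_one
  have havg' : |D - m * (N * c)| < m * (N * ε / 4) := by
    have : D - m * (N * c) = m * (D / m - N * c) := by field_simp
    rw [this, abs_mul, abs_of_pos hmpos]
    gcongr
  have hrest0 : 0 ≤ ∑ i ∈ Finset.range s, χ A (binShift^[N * m + i] y) :=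
    Finset.sum_nonneg fun i _ => (hχ01 A _).1
  have hrest1 : ∑ i ∈ Finset.range s, χ A (binShift^[N * m + i] y) ≤ s :=
    (Finset.sum_le_sum fun i _ => (hχ01 A _).2).trans (by simp)
  have hsN : (s : ℝ) < N := by exact_mod_cast hs
  have hs0 : (0 : ℝ) ≤ s := Nat.cast_nonneg s
  have hRQ : (Q : ℝ) ≤ N * m + s := by exact_mod_cast (by omega : Q ≤ N * m + s)
  have hRpos : (0 : ℝ) < N * m + s := by positivity
  have hQε := mul_le_mul_of_nonneg_right hRQ hε.le
  have hkm := mul_lt_mul_of_pos_left hkε hmpos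
  have hsc := mul_le_mul_of_nonneg_left hc1 hs0
  have hsc0 := mul_nonneg hs0 hc0
  rw [Finset.sum_range_add]
  push_cast
  rw [div_sub' hRpos.ne', abs_div, abs_of_pos hRpos, div_lt_iff₀ hRpos]
  change |_ - D| ≤ _ at hblocks
  rw [abs_le] at hblocks
  rw [abs_lt] at havg' ⊢
  constructor <;> nlinarith [hblocks.1, hblocks.2, havg'.1, havg'.2]
end
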